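/- arXiv:1612.08765 — 7 statements merged into one kernel-verified Lean document; each statement's English description precedes it below -/
import Mathlib

section
/- Let 0 = V_0 < V_1 < ⋯ < V_l = ℝ^n be a strictly increasing chain of linear subspaces of ℝ^n. Then there exists a permutation σ of {1, …, n} such that for every 0 ≤ i ≤ l, the coordinate projection of ℝ^n onto the coordinates σ(1), σ(2), …, σ(dim V_i) restricted to V_i is injective. -/
/-- The positions of the leading (first nonzero) coordinates of vectors of `V`. -/
def leadingPositions {n : ℕ} (V : Submodule ℝ (Fin n → ℝ)) : Set (Fin n) :=
  {j | ∃ x ∈ V, x j ≠ 0 ∧ ∀ k < j, x k = 0}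

theorem leadingPositions_mono {n : ℕ} {V W : Submodule ℝ (Fin n → ℝ)} (h : V ≤ W) :
    leadingPositions V ⊆ leadingPositions W :=
  fun _ ⟨x, hx, hxj⟩ => ⟨x, h hx, hxj⟩

theorem mem_leadingPositions_top {n : ℕ} (j : Fin n) :
    j ∈ leadingPositions (⊤ : Submodule ℝ (Fin n → ℝ)) :=
  ⟨Pi.single j 1, trivial, by simp, fun k hk => by simp [hk.ne]⟩

/-- A vector of `V` vanishing at all leading positions of `V` is zero. -/
theorem eq_zero_of_forall_leadingPositions {n : ℕ} {V : Submodule ℝ (Fin n → ℝ)}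
    {x : Fin n → ℝ} (hx : x ∈ V) (h : ∀ j ∈ leadingPositions V, x j = 0) : x = 0 := by
  funext j
  induction j using WellFoundedLT.induction with
  | _ j ih =>
    by_contra hj
    exact hj (h j ⟨x, hx, hj, ih⟩)

/-- A subspace has as many leading positions as its dimension. -/
theorem card_leadingPositions {n : ℕ} (V : Submodule ℝ (Fin n → ℝ)) :
    Nat.card (leadingPositions V) = Module.finrank ℝ V := by
  classical
  have := Fintype.ofFinite (leadingPositions V)
  rw [Nat.card_eq_fintype_card]
  apply le_antisymm
  · choose b hbV hb hb' using fun j : leadingPositions V => j.2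
    have hli : LinearIndependent ℝ (fun j => (⟨b j, hbV j⟩ : V)) := by
      apply LinearIndependent.of_comp V.subtype
      rw [Fintype.linearIndependent_iff]
      intro c hc j
      induction j using WellFoundedLT.induction with
      | _ j ih =>
        have h := congrFun hc j
        simp only [Function.comp_apply, Submodule.subtype_apply, Finset.sum_apply, Pi.smul_apply,
          smul_eq_mul, Pi.zero_apply] at h
        rw [Finset.sum_eq_single j] at h
        · exact (mul_eq_zero.mp h).resolve_right (hb j)
        · intro i _ hij
          rcases lt_or_gt_of_ne hij with hlt | hgt
          · rw [ih i hlt, zero_mul]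
          · rw [hb' i j hgt, mul_zero]
        · simp
    exact hli.fintype_card_le_finrank
  · let f : V →ₗ[ℝ] (leadingPositions V → ℝ) :=
      (LinearMap.funLeft ℝ ℝ ((↑) : leadingPositions V → Fin n)).comp V.subtype
    have hf : Function.Injective f := by
      rw [injective_iff_map_eq_zero]
      intro x hx
      exact Subtype.ext
        (eq_zero_of_forall_leadingPositions x.2 fun j hj => congrFun hx ⟨j, hj⟩)
    simpa using LinearMap.finrank_le_finrank_of_injective hf

/-- for a strictly increasing chain of subspaces `0 = V 0 < … < V l = ℝ^n`
there is a permutation `σ` of the coordinates such that for each `i`, the projection onto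
the first `dim (V i)` coordinates in the order given by `σ` is injective on `V i`. -/
theorem stmt3 (n l : ℕ) (V : Fin (l + 1) → Submodule ℝ (Fin n → ℝ))
    (hmono : StrictMono V) (hbot : V 0 = ⊥) (htop : V (Fin.last l) = ⊤) :
    ∃ σ : Equiv.Perm (Fin n), ∀ i : Fin (l + 1),
      Set.InjOn
        (fun x : Fin n → ℝ =>
          Set.indicator (⇑σ '' {j : Fin n | (j : ℕ) < Module.finrank ℝ (V i)}) x)
        (V i : Set (Fin n → ℝ)) := by
  classical
  let f : Fin n → ℕ := fun j =>
    sInf {m | ∃ i : Fin (l + 1), i.val = m ∧ j ∈ leadingPositions (V i)}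
  have hf (i : Fin (l + 1)) (j : Fin n) : f j ≤ i ↔ j ∈ leadingPositions (V i) := by
    constructor
    · intro h
      obtain ⟨i', hi', hj⟩ := Nat.sInf_mem
        (s := {m | ∃ i : Fin (l + 1), i.val = m ∧ j ∈ leadingPositions (V i)})
        ⟨l, Fin.last l, rfl, by rw [htop]; exact mem_leadingPositions_top j⟩
      exact leadingPositions_mono (hmono.monotone (Fin.le_def.mpr (hi'.trans_le h))) hj
    · exact fun h => Nat.sInf_le ⟨i, rfl, h⟩
  refine ⟨Tuple.sort f, fun i x hx y hy hxy => ?_⟩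
  have hcard : Fintype.card {k // (f ∘ Tuple.sort f) k ≤ i} = Module.finrank ℝ (V i) := by
    rw [← card_leadingPositions, ← Nat.card_eq_fintype_card]
    exact Nat.card_congr ((Tuple.sort f).subtypeEquiv fun k => hf i _)
  rw [← sub_eq_zero]
  refine eq_zero_of_forall_leadingPositions ((V i).sub_mem hx hy) fun j hj => ?_
  have hmem : j ∈ Tuple.sort f '' {k : Fin n | (k : ℕ) < Module.finrank ℝ (V i)} := by
    refine ⟨(Tuple.sort f).symm j, ?_, by simp⟩
    rw [Set.mem_ofPred_eq, ← hcard, Fintype.card_subtype,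
      Tuple.lt_card_le_iff_apply_le_of_monotone (Tuple.monotone_sort f)]
    simpa using (hf i j).mpr hj
  have h := congrFun hxy j
  simp only [Set.indicator_of_mem hmem] at h
  simp [h]
end

section
/- If U_1 ⊆ U_2 are open convex subsets of ℝ^n with U_1 nonempty, then invdim(U_1) ≤ invdim(U_2), where invdim denotes the invariance dimension. -/
/-- The translation stabilizer `{v | ∀ t : ℝ, U + t•v = U}`, which is a linear subspace. -/
def invStab {E : Type*} [AddCommGroup E] [Module ℝ E] (U : Set E) : Submodule ℝ E where
  carrier := {v | ∀ t : ℝ, (fun x => x + t • v) '' U = U}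
  zero_mem' := by intro t; simp
  add_mem' := by
    intro v w hv hw t
    have h : (fun x => x + t • (v + w)) = (fun x => x + t • w) ∘ (fun x => x + t • v) := by
      funext x; simp [smul_add, add_assoc]
    rw [h, Set.image_comp, hv t, hw t]
  smul_mem' := by
    intro c v hv t
    simp only [smul_smul]
    exact hv (t * c)

/-- The invariance dimension of a set: the dimension of its translation stabilizer. -/
noncomputable def invdim {E : Type*} [AddCommGroup E] [Module ℝ E] (U : Set E) : ℕ :=
  Module.finrank ℝ (invStab U)

/-- Translating an open convex set along a line it contains maps the set into itself. -/
theorem Convex.add_mem_of_isOpen_of_line_mem {E : Type*} [AddCommGroup E] [Module ℝ E]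
    [TopologicalSpace E] [ContinuousAdd E] [ContinuousSMul ℝ E] {U : Set E} (hU : Convex ℝ U)
    (hopen : IsOpen U) {p v : E} (hline : ∀ t : ℝ, p + t • v ∈ U) {y : E} (hy : y ∈ U) :
    y + v ∈ U := by
  have hcont : Continuous fun e : ℝ => y + e • (y - p) := by fun_prop
  have hmem : ∀ᶠ e in nhds (0 : ℝ), y + e • (y - p) ∈ U :=
    hcont.continuousAt.eventually (hopen.mem_nhds (by simpa using hy))
  obtain ⟨e, he, hepos⟩ :=
    ((hmem.filter_mono nhdsWithin_le_nhds).and (self_mem_nhdsWithin (s := Set.Ioi 0))).exists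
  have hepos : 0 < e := hepos
  have hcomb := hU he (hline ((1 + e) / e)) (a := 1 / (1 + e)) (b := e / (1 + e))
    (by positivity) (by positivity) (by field_simp)
  convert hcomb using 1
  match_scalars <;> field_simp
  ring

/-- The translation stabilizer is monotone on nonempty subsets of an open convex set. -/
theorem invStab_le_of_subset {E : Type*} [AddCommGroup E] [Module ℝ E] [TopologicalSpace E]
    [ContinuousAdd E] [ContinuousSMul ℝ E] {U V : Set E} (hV : Convex ℝ V) (hopen : IsOpen V)
    (hne : U.Nonempty) (hsub : U ⊆ V) : invStab U ≤ invStab V := by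
  obtain ⟨p, hp⟩ := hne
  intro v hv
  have hline : ∀ t : ℝ, p + t • v ∈ V := fun t => hsub ((hv t).subset ⟨p, hp, rfl⟩)
  have htrans : ∀ (t : ℝ) {y : E}, y ∈ V → y + t • v ∈ V := fun t y hy =>
    hV.add_mem_of_isOpen_of_line_mem hopen (fun s => by simpa [smul_smul] using hline (s * t)) hy
  intro t
  refine Set.Subset.antisymm (Set.image_subset_iff.mpr fun y hy => htrans t hy) fun y hy => ?_
  exact ⟨y + (-t) • v, htrans (-t) hy, by simp⟩

/-- if `U₁ ⊆ U₂` are open convex subsets of `ℝ^n` with `U₁` nonempty, then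
`invdim U₁ ≤ invdim U₂`. -/
theorem stmt4 (n : ℕ) (U₁ U₂ : Set (Fin n → ℝ))
    (h₁open : IsOpen U₁) (h₂open : IsOpen U₂)
    (h₁conv : Convex ℝ U₁) (h₂conv : Convex ℝ U₂)
    (hne : U₁.Nonempty) (hsub : U₁ ⊆ U₂) :
    invdim U₁ ≤ invdim U₂ :=
  Submodule.finrank_mono (invStab_le_of_subset h₂conv h₂open hne hsub)
end

section
/- Let U ⊆ ℝ^n be an open convex set containing 0 with invdim(U) = 0, and let C := S^{n−1} ∩ A(U), where S^{n−1} is the Euclidean unit sphere and A(U) = {x : for all λ > 0, λ·x ∈ U} is the recession cone of U. Then 0 does not belong to the convex hull of C. -/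
section

variable {E : Type*} [AddCommGroup E] [Module ℝ E] [TopologicalSpace E] [ContinuousSMul ℝ E]
  {U : Set E}

/-- An open convex set is stable under translation by its recession directions. -/
theorem Convex.add_mem_of_forall_smul_mem (hconv : Convex ℝ U) (hopen : IsOpen U) {u z : E}
    (hu : u ∈ U) (hz : ∀ l : ℝ, 0 < l → l • z ∈ U) : u + z ∈ U := by
  have hc : Continuous fun s : ℝ => s • u := by fun_prop
  have hnhds : ∀ᶠ s : ℝ in nhds 1, s • u ∈ U :=
    hc.continuousAt.eventually (hopen.mem_nhds (by simpa using hu))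
  obtain ⟨s, hs, hs1⟩ :=
    ((hnhds.filter_mono nhdsWithin_le_nhds).and (self_mem_nhdsWithin (s := Set.Ioi (1 : ℝ)))).exists
  have hs1 : 1 < s := hs1
  have hs0 : 0 < s := by linarith
  have hsub : 0 < s - 1 := by linarith
  have h := hconv hs (hz (s / (s - 1)) (by positivity)) (a := 1 / s) (b := (s - 1) / s)
    (by positivity) (by positivity) (by field_simp; ring)
  have h1 : 1 / s * s = 1 := by field_simp
  have h2 : (s - 1) / s * (s / (s - 1)) = 1 := by field_simp
  simpa only [smul_smul, h1, h2, one_smul] using h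

/-- A direction whose whole line is recessive belongs to the translation stabilizer. -/
theorem mem_invStab_of_forall_smul_mem (hconv : Convex ℝ U) (hopen : IsOpen U) {z : E}
    (hz : ∀ l : ℝ, 0 < l → l • z ∈ U) (hz' : ∀ l : ℝ, 0 < l → l • -z ∈ U) :
    z ∈ invStab U := by
  have key : ∀ (t : ℝ), ∀ u ∈ U, u + t • z ∈ U := by
    intro t u hu
    rcases lt_trichotomy t 0 with ht | rfl | ht
    · refine hconv.add_mem_of_forall_smul_mem hopen hu fun l hl => ?_
      have := hz' (l * -t) (mul_pos hl (neg_pos.2 ht))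
      simpa [smul_smul] using this
    · simpa using hu
    · refine hconv.add_mem_of_forall_smul_mem hopen hu fun l hl => ?_
      simpa [smul_smul] using hz (l * t) (mul_pos hl ht)
  intro t
  apply Set.Subset.antisymm
  · rintro _ ⟨u, hu, rfl⟩
    exact key t u hu
  · intro u hu
    exact ⟨u + (-t) • z, key (-t) u hu, by simp⟩

/-- If the translation stabilizer of an open convex set is trivial, its nonzero recession
directions form a convex set. -/
theorem convex_setOf_ne_zero_forall_smul_mem (hconv : Convex ℝ U) (hopen : IsOpen U)
    (hinv : invStab U = ⊥) :
    Convex ℝ {x : E | x ≠ 0 ∧ ∀ l : ℝ, 0 < l → l • x ∈ U} := by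
  rintro x ⟨hx0, hx⟩ y ⟨hy0, hy⟩ a b ha hb hab
  refine ⟨fun h => ?_, fun l hl => ?_⟩
  · rcases ha.eq_or_lt with rfl | ha
    · obtain rfl : b = 1 := by linarith
      exact hy0 (by simpa using h)
    rcases hb.eq_or_lt with rfl | hb
    · obtain rfl : a = 1 := by linarith
      exact hx0 (by simpa using h)
    have hneg : -x = (b / a) • y := by
      rw [div_eq_inv_mul, mul_smul, ← neg_eq_of_add_eq_zero_right h, smul_neg,
        inv_smul_smul₀ ha.ne']
    have hmem := mem_invStab_of_forall_smul_mem hconv hopen hx fun l hl => by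
      rw [hneg, smul_smul]
      exact hy _ (by positivity)
    rw [hinv] at hmem
    exact hx0 ((Submodule.mem_bot ℝ).1 hmem)
  · rw [smul_add, smul_comm l a, smul_comm l b]
    exact hconv (hx l hl) (hy l hl) ha hb hab

end

/-- for an open convex `U ⊆ ℝ^n` containing `0` with `invdim U = 0`, the
origin is not in the convex hull of `C = S^{n-1} ∩ A(U)`, where `A(U)` is the recession
cone of `U`. -/
theorem stmt8 (n : ℕ) (U : Set (EuclideanSpace ℝ (Fin n)))
    (hopen : IsOpen U) (hconv : Convex ℝ U) (h0 : (0 : EuclideanSpace ℝ (Fin n)) ∈ U)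
    (hinv : invdim U = 0) :
    (0 : EuclideanSpace ℝ (Fin n)) ∉
      convexHull ℝ ({x : EuclideanSpace ℝ (Fin n) | ‖x‖ = 1} ∩
        {x : EuclideanSpace ℝ (Fin n) | ∀ l : ℝ, 0 < l → l • x ∈ U}) := by
  have hbot : invStab U = ⊥ := Submodule.finrank_eq_zero.1 hinv
  intro h
  refine (convexHull_min ?_ (convex_setOf_ne_zero_forall_smul_mem hconv hopen hbot) h).1 rfl
  rintro x ⟨hx1, hx⟩
  refine ⟨?_, hx⟩
  rintro rfl
  simp at hx1
end

section
/- Let U ⊆ ℝ^n be an unbounded open convex set with invdim(U) = 0. Then there exists a linear functional φ : ℝ^n → ℝ such that for every r > 0 the set {x ∈ U : φ(x) < r} is bounded. -/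
open Filter Topology

/-- The recession cone of the closure of a set. -/
def closedRecession {E : Type*} [NormedAddCommGroup E] [NormedSpace ℝ E] (U : Set E) : Set E :=
  {v | ∀ x ∈ closure U, ∀ t : ℝ, 0 ≤ t → x + t • v ∈ closure U}

section

variable {E : Type*} [NormedAddCommGroup E] [NormedSpace ℝ E] {U : Set E}

lemma isClosed_closedRecession : IsClosed (closedRecession U) := by
  simp only [closedRecession, Set.ofPred_forall]
  refine isClosed_iInter fun x => isClosed_iInter fun _ => isClosed_iInter fun t =>
    isClosed_iInter fun _ => ?_
  exact isClosed_closure.preimage (f := fun v : E => x + t • v) (by fun_prop)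

lemma smul_mem_closedRecession {v : E} (hv : v ∈ closedRecession U) {c : ℝ} (hc : 0 ≤ c) :
    c • v ∈ closedRecession U := by
  intro x hx t ht
  rw [smul_smul]
  exact hv x hx _ (mul_nonneg ht hc)

lemma add_mem_closedRecession {v w : E} (hv : v ∈ closedRecession U)
    (hw : w ∈ closedRecession U) : v + w ∈ closedRecession U := by
  intro x hx t ht
  rw [smul_add, ← add_assoc]
  exact hw _ (hv x hx t ht) t ht

lemma mem_invStab_of_mem_closedRecession (hopen : IsOpen U) (hconv : Convex ℝ U)
    (hne : U.Nonempty) {v : E} (hv : v ∈ closedRecession U) (hv' : -v ∈ closedRecession U) :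
    v ∈ invStab U := by
  have hint : interior (closure U) = U := by
    rw [hconv.interior_closure_eq_interior_of_nonempty_interior
      (by rwa [hopen.interior_eq]), hopen.interior_eq]
  have hcl : ∀ x ∈ closure U, ∀ t : ℝ, x + t • v ∈ closure U := by
    intro x hx t
    rcases le_total 0 t with ht | ht
    · exact hv x hx t ht
    · simpa using hv' x hx (-t) (neg_nonneg.2 ht)
  have hsub : ∀ t : ℝ, (fun x => x + t • v) '' U ⊆ U := by
    intro t
    conv_rhs => rw [← hint]
    refine interior_maximal ?_ ((Homeomorph.addRight (t • v)).isOpenMap U hopen)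
    rintro _ ⟨x, hx, rfl⟩
    exact hcl x (subset_closure hx) t
  intro t
  refine (hsub t).antisymm fun x hx => ⟨x + (-t) • v, hsub (-t) ⟨x, hx, rfl⟩, ?_⟩
  simp

/-- A point outside a closed recession cone is separated from it by a functional that is
nonnegative on the cone. -/
lemma exists_nonneg_on_closedRecession_of_notMem {w : E} (hw : w ∉ closedRecession U) :
    ∃ φ : E →L[ℝ] ℝ, (∀ v ∈ closedRecession U, 0 ≤ φ v) ∧ φ w < 0 := by
  have hC : Convex ℝ (closedRecession U) := fun x hx y hy a b ha hb _ =>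
    add_mem_closedRecession (smul_mem_closedRecession hx ha) (smul_mem_closedRecession hy hb)
  obtain ⟨φ, u, hu, hφ⟩ := geometric_hahn_banach_point_closed hC isClosed_closedRecession hw
  have hu0 : u < 0 := by
    have hzero : (0 : E) ∈ closedRecession U := fun x hx t _ => by simpa using hx
    simpa using hφ 0 hzero
  refine ⟨φ, fun v hv => ?_, hu.trans hu0⟩
  by_contra! hneg
  have h := hφ _ (smul_mem_closedRecession hv (div_nonneg_of_nonpos hu0.le hneg.le))
  rw [map_smul, smul_eq_mul, div_mul_cancel₀ _ hneg.ne] at h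
  exact lt_irrefl _ h

/-- In finite dimension, a closed recession cone without lines lies, apart from the origin,
in an open half-space. -/
lemma exists_pos_on_closedRecession [FiniteDimensional ℝ E]
    (hpt : ∀ v ∈ closedRecession U, -v ∈ closedRecession U → v = 0) :
    ∃ φ : E →L[ℝ] ℝ, ∀ v ∈ closedRecession U, ‖v‖ = 1 → 0 < φ v := by
  have hcompact : IsCompact (closedRecession U ∩ Metric.sphere 0 1) :=
    (isCompact_sphere (0 : E) 1).inter_left isClosed_closedRecession
  have key : ∃ φ : E →L[ℝ] ℝ, (∀ v ∈ closedRecession U, 0 ≤ φ v) ∧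
      ∀ v ∈ closedRecession U ∩ Metric.sphere 0 1, v ∈ closedRecession U → 0 < φ v := by
    refine hcompact.induction_on
      (p := fun s => ∃ φ : E →L[ℝ] ℝ, (∀ v ∈ closedRecession U, 0 ≤ φ v) ∧
        ∀ v ∈ s, v ∈ closedRecession U → 0 < φ v) ⟨0, by simp⟩ ?_ ?_ ?_
    · rintro s t hst ⟨φ, hφ, hpos⟩
      exact ⟨φ, hφ, fun v hv => hpos v (hst hv)⟩
    · rintro s t ⟨φ, hφ, hs⟩ ⟨χ, hχ, ht⟩
      refine ⟨φ + χ, fun v hv => add_nonneg (hφ v hv) (hχ v hv), ?_⟩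
      rintro v (hv | hv) hvC
      · exact add_pos_of_pos_of_nonneg (hs v hv hvC) (hχ v hvC)
      · exact add_pos_of_nonneg_of_pos (hφ v hvC) (ht v hv hvC)
    · rintro v ⟨hv, hv1⟩
      have hneg : -v ∉ closedRecession U := fun h => by
        simp [hpt v hv h] at hv1
      obtain ⟨φ, hφ, hφv⟩ := exists_nonneg_on_closedRecession_of_notMem hneg
      refine ⟨{x | 0 < φ x}, mem_nhdsWithin_of_mem_nhds
        ((isOpen_lt continuous_const φ.continuous).mem_nhds ?_), φ, hφ, fun x hx _ => hx⟩
      simpa using hφv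
  obtain ⟨φ, -, hφ⟩ := key
  exact ⟨φ, fun v hv hv1 => hφ v ⟨hv, by simpa using hv1⟩ hv⟩

/-- Limits of directions of points of a convex set going to infinity are recession directions. -/
lemma mem_closedRecession_of_tendsto (hconv : Convex ℝ U) {y : ℕ → E} (hy : ∀ k, y k ∈ U)
    (hnorm : Tendsto (fun k => ‖y k‖) atTop atTop) {v : E}
    (hv : Tendsto (fun k => ‖y k‖⁻¹ • y k) atTop (𝓝 v)) : v ∈ closedRecession U := by
  intro x hx t ht
  have hinv : Tendsto (fun k => t * ‖y k‖⁻¹) atTop (𝓝 0) := by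
    simpa using hnorm.inv_tendsto_atTop.const_mul t
  have hlim : Tendsto (fun k => (1 - t * ‖y k‖⁻¹) • x + (t * ‖y k‖⁻¹) • y k) atTop
      (𝓝 (x + t • v)) := by
    have h := ((hinv.const_sub 1).smul_const x).add (hv.const_smul t)
    simpa [smul_smul] using h
  refine isClosed_closure.mem_of_tendsto hlim ?_
  filter_upwards [hinv.eventually_le_const zero_lt_one] with k hk
  exact hconv.closure hx (subset_closure (hy k)) (sub_nonneg.2 hk) (by positivity) (by ring)

lemma isBounded_sublevel [FiniteDimensional ℝ E] (hconv : Convex ℝ U) {φ : E →L[ℝ] ℝ}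
    (hφ : ∀ v ∈ closedRecession U, ‖v‖ = 1 → 0 < φ v) (r : ℝ) :
    Bornology.IsBounded {x | x ∈ U ∧ φ x < r} := by
  by_contra hb
  have hex : ∀ k : ℕ, ∃ x, (x ∈ U ∧ φ x < r) ∧ (k : ℝ) + 1 < ‖x‖ := by
    intro k
    by_contra! h
    exact hb (isBounded_iff_forall_norm_le.2 ⟨k + 1, h⟩)
  choose y hy hyk using hex
  have hypos : ∀ k, 0 < ‖y k‖ := fun k => lt_trans (by positivity) (hyk k)
  have hnorm : Tendsto (fun k => ‖y k‖) atTop atTop :=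
    tendsto_atTop_mono (fun k => by linarith [hyk k]) tendsto_natCast_atTop_atTop
  obtain ⟨v, hv1, ψ, hψ, hv⟩ := (isCompact_sphere (0 : E) 1).tendsto_subseq
    (x := fun k => ‖y k‖⁻¹ • y k) (fun k => by
      simp [norm_smul, (hypos k).ne'])
  have hnorm' := hnorm.comp hψ.tendsto_atTop
  have hpos := hφ v (mem_closedRecession_of_tendsto hconv (y := y ∘ ψ)
    (fun k => (hy (ψ k)).1) hnorm' hv) (by simpa using hv1)
  have hr : Tendsto (fun k => ‖y (ψ k)‖⁻¹ * r) atTop (𝓝 0) := by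
    simpa using hnorm'.inv_tendsto_atTop.mul_const r
  refine hpos.not_ge (le_of_tendsto_of_tendsto' ((φ.continuous.tendsto v).comp hv) hr fun k => ?_)
  simp only [Function.comp_apply, map_smul, smul_eq_mul]
  exact mul_le_mul_of_nonneg_left (hy (ψ k)).2.le (by positivity)

end


/-- if `U ⊆ ℝ^n` is an unbounded open convex set with `invdim U = 0`, then
there is a linear functional `φ` such that `{x ∈ U | φ x < r}` is bounded for every
`r > 0`. -/
theorem stmt9 (n : ℕ) (U : Set (Fin n → ℝ))
    (hopen : IsOpen U) (hconv : Convex ℝ U)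
    (hunb : ¬ Bornology.IsBounded U) (hinv : invdim U = 0) :
    ∃ φ : (Fin n → ℝ) →ₗ[ℝ] ℝ, ∀ r : ℝ, 0 < r →
      Bornology.IsBounded {x | x ∈ U ∧ φ x < r} := by
  have hne : U.Nonempty := by
    rw [Set.nonempty_iff_ne_empty]
    rintro rfl
    exact hunb Bornology.isBounded_empty
  have hbot : invStab U = ⊥ := Submodule.finrank_eq_zero.1 hinv
  obtain ⟨φ, hφ⟩ := exists_pos_on_closedRecession (U := U) fun v hv hv' => by
    simpa [hbot] using mem_invStab_of_mem_closedRecession hopen hconv hne hv hv'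
  exact ⟨φ.toLinearMap, fun r _ => isBounded_sublevel hconv hφ r⟩
end

section
/- Let V be a finite-dimensional real vector space of dimension d, let ψ_1, …, ψ_l : V → ℝ be linearly independent linear functionals, and let c_1, …, c_l ∈ ℝ. Then the set P = {x ∈ V : ψ_k(x) < c_k for all 1 ≤ k ≤ l} is a nonempty open convex set, its translation stabilizer {v ∈ V : P + v = P} equals ⋂_{k=1}^{l} ker ψ_k, and hence invdim(P) = d − l. -/
/-- Linearly independent functionals are jointly surjective. -/
theorem LinearIndependent.surjective_pi_dual {K V ι : Type*} [Field K] [AddCommGroup V]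
    [Module K V] [Fintype ι] {ψ : ι → (V →ₗ[K] K)} (hψ : LinearIndependent K ψ) :
    Function.Surjective (LinearMap.pi ψ) := by
  classical
  rw [← LinearMap.range_eq_top]
  by_contra h
  obtain ⟨f, hf, hmap⟩ := Submodule.exists_dual_map_eq_bot_of_lt_top (lt_top_iff_ne_top.2 h)
    inferInstance
  refine hf (LinearMap.pi_ext' fun i => LinearMap.ext_ring ?_)
  refine Fintype.linearIndependent_iff.1 hψ (fun i => f (Pi.single i 1)) ?_ i
  ext x
  have hx : f (LinearMap.pi ψ x) = 0 := by
    rw [← Submodule.mem_bot K, ← hmap]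
    exact Submodule.mem_map_of_mem (LinearMap.mem_range_self _ x)
  rw [pi_eq_sum_univ' (LinearMap.pi ψ x)] at hx
  simpa [mul_comm, ← Pi.single_apply] using hx

/-- Translation by `v` preserves an intersection of half-spaces with linearly independent normals
iff every normal vanishes at `v`. -/
theorem image_add_halfspaces_eq_iff {V ι : Type*} [AddCommGroup V] [Module ℝ V] [Fintype ι]
    {ψ : ι → (V →ₗ[ℝ] ℝ)} (hψ : LinearIndependent ℝ ψ) (c : ι → ℝ) (v : V) :
    (fun x => x + v) '' {x : V | ∀ k, ψ k x < c k} = {x : V | ∀ k, ψ k x < c k} ↔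
      ∀ k, ψ k v = 0 := by
  constructor
  · intro h k
    by_contra hv
    obtain ⟨x, hx⟩ := hψ.surjective_pi_dual fun j => c j - |ψ k v| / 2
    have hx' (j) : ψ j x = c j - |ψ k v| / 2 := congrFun hx j
    have hpos := abs_pos.2 hv
    have hxP : x ∈ {x : V | ∀ k, ψ k x < c k} := fun j => by rw [hx' j]; linarith
    have hadd : x + v ∈ {x : V | ∀ k, ψ k x < c k} := h ▸ Set.mem_image_of_mem _ hxP
    have h₁ := hadd k
    rw [← h] at hxP
    obtain ⟨y, hy, hyx⟩ := hxP
    have h₂ := hy k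
    have h₃ := congrArg (ψ k) hyx
    simp only [map_add, hx'] at h₁ h₃
    rcases abs_cases (ψ k v) with h₄ | h₄ <;> linarith
  · intro h
    rw [Set.image_add_right]
    ext x
    simp [h]

/-- for linearly independent functionals `ψ 1, …, ψ l` on a `d`-dimensional
real vector space `V` and reals `c k`, the set `P = {x | ∀ k, ψ k x < c k}` is a nonempty
open convex set, its translation stabilizer is `⋂ k, ker (ψ k)`, and `invdim P = d - l`. -/
theorem stmt10 (V : Type*) [NormedAddCommGroup V] [NormedSpace ℝ V] [FiniteDimensional ℝ V]
    (d : ℕ) (hd : Module.finrank ℝ V = d) (l : ℕ) (ψ : Fin l → (V →ₗ[ℝ] ℝ))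
    (hψ : LinearIndependent ℝ ψ) (c : Fin l → ℝ) :
    ({x : V | ∀ k, ψ k x < c k}).Nonempty ∧
    IsOpen {x : V | ∀ k, ψ k x < c k} ∧
    Convex ℝ {x : V | ∀ k, ψ k x < c k} ∧
    {v : V | (fun x => x + v) '' {x : V | ∀ k, ψ k x < c k} = {x : V | ∀ k, ψ k x < c k}}
      = ⋂ k, (LinearMap.ker (ψ k) : Set V) ∧
    invdim {x : V | ∀ k, ψ k x < c k} = d - l := by
  have hsurj := hψ.surjective_pi_dual
  refine ⟨?_, ?_, ?_, ?_, ?_⟩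
  · obtain ⟨x, hx⟩ := hsurj fun k => c k - 1
    exact ⟨x, fun k => by
      have hk : ψ k x = c k - 1 := congrFun hx k
      rw [hk]; linarith⟩
  · simp only [Set.ofPred_forall]
    exact isOpen_iInter_of_finite fun k =>
      isOpen_lt (ψ k).continuous_of_finiteDimensional continuous_const
  · simp only [Set.ofPred_forall]
    exact convex_iInter fun k => convex_halfSpace_lt (ψ k).isLinear (c k)
  · ext v
    simpa using image_add_halfspaces_eq_iff hψ c v
  · have hstab : invStab {x : V | ∀ k, ψ k x < c k} = LinearMap.ker (LinearMap.pi ψ) := by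
      ext v
      change (∀ t : ℝ, _ = _) ↔ _
      simp only [image_add_halfspaces_eq_iff hψ, LinearMap.mem_ker, funext_iff,
        LinearMap.pi_apply, Pi.zero_apply, map_smul, smul_eq_mul]
      exact ⟨fun h k => by simpa using h 1 k, fun h t k => by simp [h k]⟩
    have hrank := LinearMap.finrank_range_add_finrank_ker (LinearMap.pi ψ)
    rw [LinearMap.range_eq_top.2 hsurj, finrank_top, Module.finrank_fin_fun, hd] at hrank
    rw [invdim, hstab]
    lia
end

section
/- Let (C^{p,q})_{p,q ≥ 0} be a double complex of abelian groups with differentials d : C^{p,q} → C^{p,q+1} and δ : C^{p,q} → C^{p+1,q} satisfying d∘d = 0, δ∘δ = 0 and d∘δ = δ∘d. Let the total complex be C^r = ⊕_{p+q=r} C^{p,q} with total differential D acting on the summand C^{p,q} by D = (−1)^q δ + d. Fix r ≥ 0 and assume δ is exact at all groups of degree r, i.e., for every p ≥ 1 and q with p + q = r, ker(δ : C^{p,q} → C^{p+1,q}) = im(δ : C^{p−1,q} → C^{p,q}). Then every α ∈ C^r with Dα = 0 is congruent modulo im(D : C^{r−1} → C^r) to an element of the summand C^{0,r}; that is, every total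 cohomology class of degree r has a representative in C^{0,r}. -/
/-- Transport an element of a doubly-indexed family along equalities of the indices. -/
def castC (C : ℕ → ℕ → Type*) {p q p' q' : ℕ} (hp : p = p') (hq : q = q')
    (x : C p q) : C p' q' :=
  cast (by rw [hp, hq]) x

/-- The total differential of a double complex, acting on families `α : ∀ p q, C p q`:
`(D α) (p,q) = d (α (p, q-1)) + (-1)^q δ (α (p-1, q))`, i.e. `D` restricts to
`(-1)^q δ + d` on the summand `C^{p,q}`. -/
def Dfun (C : ℕ → ℕ → Type*) [∀ p q, AddCommGroup (C p q)]
    (d : ∀ p q, C p q →+ C p (q + 1)) (δ : ∀ p q, C p q →+ C (p + 1) q)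
    (α : ∀ p q, C p q) : ∀ p q, C p q :=
  fun p q =>
    (if h : 1 ≤ q then castC C rfl (by omega) (d p (q - 1) (α p (q - 1))) else 0) +
    (if h : 1 ≤ p then
      ((-1 : ℤ) ^ q) • castC C (by omega) rfl (δ (p - 1) q (α (p - 1) q)) else 0)

section TotalDifferential

variable {C : ℕ → ℕ → Type*} [∀ p q, AddCommGroup (C p q)]
  {d : ∀ p q, C p q →+ C p (q + 1)} {δ : ∀ p q, C p q →+ C (p + 1) q}

theorem Dfun_succ_zero (α : ∀ p q, C p q) (p : ℕ) :
    Dfun C d δ α (p + 1) 0 = δ p 0 (α p 0) := by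
  simp [Dfun, castC]

theorem Dfun_succ_succ (α : ∀ p q, C p q) (p q : ℕ) :
    Dfun C d δ α (p + 1) (q + 1) =
      d (p + 1) q (α (p + 1) q) + ((-1 : ℤ) ^ (q + 1)) • δ p (q + 1) (α p (q + 1)) := by
  simp [Dfun, castC]

theorem d_Dfun_succ (hdd : ∀ p q (x : C p q), d p (q + 1) (d p q x) = 0)
    (hcomm : ∀ p q (x : C p q), d (p + 1) q (δ p q x) = δ p (q + 1) (d p q x))
    (α : ∀ p q, C p q) (p q : ℕ) :
    d (p + 1) q (Dfun C d δ α (p + 1) q) =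
      ((-1 : ℤ) ^ q) • δ p (q + 1) (d p q (α p q)) := by
  cases q with
  | zero => simp [Dfun_succ_zero, hcomm]
  | succ q => simp only [Dfun_succ_succ, map_add, map_zsmul, hdd, hcomm, zero_add]

/-- If `α` is a cocycle agreeing with `D β` at `(p + 2, q - 1)`, then `α - D β` is
`δ`-closed at `(p + 1, q)`. -/
theorem δ_sub_Dfun_eq_zero (hdd : ∀ p q (x : C p q), d p (q + 1) (d p q x) = 0)
    (hδδ : ∀ p q (x : C p q), δ (p + 1) q (δ p q x) = 0)
    (hcomm : ∀ p q (x : C p q), d (p + 1) q (δ p q x) = δ p (q + 1) (d p q x))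
    {α β : ∀ p q, C p q} (hclosed : Dfun C d δ α = 0) {p q : ℕ}
    (hβ : ∀ m, q = m + 1 → α (p + 2) m = Dfun C d δ β (p + 2) m) :
    δ (p + 1) q (α (p + 1) q - Dfun C d δ β (p + 1) q) = 0 := by
  have h : Dfun C d δ α (p + 2) q = 0 := by rw [hclosed]; rfl
  cases q with
  | zero =>
    rw [Dfun_succ_zero] at h
    rw [Dfun_succ_zero, map_sub, h, hδδ, sub_zero]
  | succ m =>
    rw [Dfun_succ_succ, hβ m rfl, d_Dfun_succ hdd hcomm] at h
    rw [Dfun_succ_succ, map_sub, map_add, map_zsmul, hδδ, smul_zero, add_zero]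
    rcases neg_one_pow_eq_or ℤ m with hm | hm <;> simp only [pow_succ, hm] at h
    · rw [← neg_eq_zero, ← h]; simp; abel
    · rw [← h]; simp; abel

theorem Dfun_update_succ (β : ∀ p q, C p q) (p q : ℕ) (z : C p q) :
    Dfun C d δ (Function.update β p (Function.update (β p) q z)) (p + 1) q =
      Dfun C d δ β (p + 1) q + ((-1 : ℤ) ^ q) • δ p q (z - β p q) := by
  cases q with
  | zero => simp [Dfun_succ_zero]
  | succ q => simp [Dfun_succ_succ, smul_sub]

theorem Dfun_update_of_lt (β : ∀ p q, C p q) (p q : ℕ) (z : C p q) {p' q' : ℕ} (h : q' < q) :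
    Dfun C d δ (Function.update β p (Function.update (β p) q z)) (p' + 1) q' =
      Dfun C d δ β (p' + 1) q' := by
  have key : ∀ a b, b < q →
      Function.update β p (Function.update (β p) q z) a b = β a b := by
    intro a b hb
    by_cases ha : a = p
    · subst ha
      simp [hb.ne]
    · simp [ha]
  cases q' with
  | zero => rw [Dfun_succ_zero, Dfun_succ_zero, key _ _ h]
  | succ q' => rw [Dfun_succ_succ, Dfun_succ_succ, key _ _ h, key _ _ (by omega)]

/-- A cocycle of degree `r` agrees with a coboundary at the positions `(p, q)`
with `p ≥ 1` and `q < n`. -/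
theorem exists_eq_Dfun_of_lt (hdd : ∀ p q (x : C p q), d p (q + 1) (d p q x) = 0)
    (hδδ : ∀ p q (x : C p q), δ (p + 1) q (δ p q x) = 0)
    (hcomm : ∀ p q (x : C p q), d (p + 1) q (δ p q x) = δ p (q + 1) (d p q x))
    {r : ℕ}
    (hexact : ∀ p q, p + 1 + q = r → ∀ x : C (p + 1) q, δ (p + 1) q x = 0 →
      ∃ y : C p q, δ p q y = x)
    {α : ∀ p q, C p q} (hclosed : Dfun C d δ α = 0) (n : ℕ) :
    ∃ β : ∀ p q, C p q, (∀ p q, p + q + 1 ≠ r → β p q = 0) ∧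
      ∀ p q, p + 1 + q = r → q < n → α (p + 1) q = Dfun C d δ β (p + 1) q := by
  induction n with
  | zero => exact ⟨fun _ _ => 0, fun _ _ _ => rfl, fun _ _ _ h => absurd h (Nat.not_lt_zero _)⟩
  | succ n ih =>
    obtain ⟨β, hβ, hD⟩ := ih
    by_cases hr : n + 1 ≤ r
    · obtain ⟨p, rfl⟩ : ∃ p, r = p + 1 + n := ⟨r - (n + 1), by omega⟩
      obtain ⟨y, hy⟩ := hexact p n rfl _ (δ_sub_Dfun_eq_zero hdd hδδ hcomm hclosed
        (β := β) fun m hm => hD (p + 1) m (by omega) (by omega))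
      refine ⟨Function.update β p (Function.update (β p) n (β p n + ((-1 : ℤ) ^ n) • y)),
        fun a b hab => ?_, fun a b hab hb => ?_⟩
      · by_cases ha : a = p
        · subst ha
          have hbn : b ≠ n := by omega
          simpa [hbn] using hβ a b hab
        · simpa [ha] using hβ a b hab
      · rcases Nat.lt_succ_iff_lt_or_eq.mp hb with hb | rfl
        · rw [Dfun_update_of_lt _ _ _ _ hb, hD a b hab hb]
        · obtain rfl : a = p := by omega
          rw [Dfun_update_succ, add_sub_cancel_left, map_zsmul, smul_smul, ← mul_pow, hy]
          simp
    · exact ⟨β, hβ, fun p q hpq _ => hD p q hpq (by omega)⟩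

end TotalDifferential

/-- in a double complex whose column differential `δ` is exact at all groups
of total degree `r`, every degree-`r` total cocycle is congruent, modulo total
coboundaries, to an element of the summand `C^{0,r}`.  Degree-`r` elements of the total
complex are encoded as families `α : ∀ p q, C p q` vanishing off the antidiagonal
`p + q = r`. -/
theorem stmt11 (C : ℕ → ℕ → Type*) [∀ p q, AddCommGroup (C p q)]
    (d : ∀ p q, C p q →+ C p (q + 1)) (δ : ∀ p q, C p q →+ C (p + 1) q)
    (hdd : ∀ p q (x : C p q), d p (q + 1) (d p q x) = 0)
    (hδδ : ∀ p q (x : C p q), δ (p + 1) q (δ p q x) = 0)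
    (hcomm : ∀ p q (x : C p q), d (p + 1) q (δ p q x) = δ p (q + 1) (d p q x))
    (r : ℕ)
    (hexact : ∀ p q, ∀ hp : 1 ≤ p, p + q = r → ∀ x : C p q, δ p q x = 0 →
      ∃ y : C (p - 1) q, castC C (by omega) rfl (δ (p - 1) q y) = x)
    (α : ∀ p q, C p q)
    (hsupp : ∀ p q, p + q ≠ r → α p q = 0)
    (hclosed : Dfun C d δ α = 0) :
    ∃ β : ∀ p q, C p q,
      (∀ p q, p + q + 1 ≠ r → β p q = 0) ∧
      ∀ p q, p + q = r → 1 ≤ p → α p q = Dfun C d δ β p q := by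
  obtain ⟨β, hβ, hD⟩ := exists_eq_Dfun_of_lt hdd hδδ hcomm (r := r)
    (fun p q hpq x hx => hexact (p + 1) q (Nat.le_add_left 1 p) hpq x hx) hclosed (r + 1)
  refine ⟨β, hβ, fun p q hpq hp => ?_⟩
  obtain ⟨p, rfl⟩ := Nat.exists_eq_add_of_le' hp
  exact hD p q hpq (by omega)
end

section
/- Let 𝔘 be a linearly ordered collection of open subsets of ℝ^n covering ℝ^n which is locally finite (every compact subset of ℝ^n intersects only finitely many members of 𝔘). For p ≥ 0 let C^p = ⊕_{J ⊆ 𝔘, #J = p+1} Ω^0_bs(U_J), where U_J = ⋂_{U ∈ J} U and Ω^0_bs(U) is the group of smooth real-valued functions on U vanishing outside some bounded set, and let δ : C^p → C^{p+1} be the Čech differential: for ω = (ω_J)_{#J=p+1}, (δω)_{J'} = Σ_{U ∈ J'} (−1)^{[U:J']} ω_{J'∖{U}} restricted to U_{J'}, where [U:J'] is the position of U in J' under the given order. Then for every p ≥ 1, ker(δ : C^p → C^{p+1}) = im(δ : C^{p−1} → C^p). -/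
/-- `Ω⁰_bs(V)`: smooth real-valued functions on the open set `V ⊆ ℝ^n` vanishing outside
some bounded set, encoded as global functions that vanish outside `V`, are smooth on `V`,
and vanish outside some ball `B(r)`. -/
def ObsSet {n : ℕ} (V : Set (Fin n → ℝ)) : Set ((Fin n → ℝ) → ℝ) :=
  {f | ContDiffOn ℝ (⊤ : ℕ∞) f V ∧ (∀ x ∉ V, f x = 0) ∧
    ∃ r : ℝ, 0 < r ∧ ∀ x : Fin n → ℝ, r ≤ ‖x‖ → f x = 0}

/-- The intersection `U_J = ⋂ i ∈ J, U i`. -/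
def UJ {n : ℕ} {ι : Type*} (U : ι → Set (Fin n → ℝ)) (J : Finset ι) :
    Set (Fin n → ℝ) :=
  ⋂ i ∈ J, U i

open Classical in
/-- The Čech differential: `(δω)_{J'} = ∑_{i ∈ J'} (-1)^{[i:J']} ω_{J' \ {i}}`, restricted
to `U_{J'}` (the position `[i:J']` is the number of elements of `J'` below `i`). -/
noncomputable def cechδ {n : ℕ} {ι : Type*} [LinearOrder ι] (U : ι → Set (Fin n → ℝ))
    (ω : Finset ι → (Fin n → ℝ) → ℝ) : Finset ι → (Fin n → ℝ) → ℝ :=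
  fun J' x =>
    if x ∈ UJ U J' then
      ∑ i ∈ J', (-1 : ℝ) ^ ((J'.filter (· < i)).card) * ω (J'.erase i) x
    else 0

/-- A Čech `p`-cochain with values in `Ω⁰_bs`: a family indexed by the `(p+1)`-element
subsets of the index set, each member lying in `Ω⁰_bs(U_J)`, with only finitely many
nonzero members, and vanishing on subsets of the wrong cardinality. -/
def IsCochain {n : ℕ} {ι : Type*} (U : ι → Set (Fin n → ℝ)) (p : ℕ)
    (ω : Finset ι → (Fin n → ℝ) → ℝ) : Prop :=
  (∀ J : Finset ι, J.card = p + 1 → ω J ∈ ObsSet (UJ U J)) ∧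
  {J : Finset ι | ω J ≠ 0}.Finite ∧
  (∀ J : Finset ι, J.card ≠ p + 1 → ω J = 0)

/-- The sign `(-1)^[i:J]` attached to the position of `i` relative to `J`. -/
def cechSign {ι : Type*} [LinearOrder ι] (i : ι) (J : Finset ι) : ℝ :=
  (-1 : ℝ) ^ (J.filter (· < i)).card

section Sign

variable {ι : Type*} [LinearOrder ι]

lemma cechSign_mul_self (i : ι) (J : Finset ι) : cechSign i J * cechSign i J = 1 := by
  rw [cechSign, ← mul_pow]; norm_num

lemma cechSign_erase_of_not_lt {i j : ι} (h : ¬ i < j) (J : Finset ι) :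
    cechSign j (J.erase i) = cechSign j J := by
  unfold cechSign
  rw [Finset.filter_erase, Finset.erase_eq_of_notMem]
  simp [h]

lemma cechSign_erase_of_lt {i j : ι} (h : i < j) {J : Finset ι} (hi : i ∈ J) :
    cechSign j (J.erase i) = -cechSign j J := by
  unfold cechSign
  have hm : i ∈ J.filter (· < j) := by simp [h, hi]
  rw [Finset.filter_erase, ← Finset.card_erase_add_one hm, pow_succ]
  ring

lemma cechSign_mul_erase {i j : ι} (hij : i ≠ j) {J : Finset ι} (hi : i ∈ J) (hj : j ∈ J) :
    cechSign i J * cechSign j (J.erase i) = -(cechSign j J * cechSign i (J.erase j)) := by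
  rcases lt_or_gt_of_ne hij with h | h
  · rw [cechSign_erase_of_lt h hi, cechSign_erase_of_not_lt h.not_gt]; ring
  · rw [cechSign_erase_of_lt h hj, cechSign_erase_of_not_lt h.not_gt]; ring

/-- The algebraic Čech differential of a family of real numbers squares to zero. -/
lemma sum_cechSign_sum_cechSign (w : Finset ι → ℝ) (J : Finset ι) :
    ∑ i ∈ J, cechSign i J * ∑ j ∈ J.erase i, cechSign j (J.erase i) * w ((J.erase i).erase j)
      = 0 := by
  simp_rw [Finset.mul_sum]
  rw [Finset.sum_sigma']
  refine Finset.sum_involution (fun a _ => ⟨a.2, a.1⟩) ?_ ?_ ?_ ?_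
  · rintro ⟨i, j⟩ ha
    simp only [Finset.mem_sigma, Finset.mem_erase] at ha
    dsimp only
    rw [← mul_assoc, ← mul_assoc, cechSign_mul_erase (Ne.symm ha.2.1) ha.1 ha.2.2,
      Finset.erase_right_comm]
    ring
  · rintro ⟨i, j⟩ ha _ h
    simp only [Finset.mem_sigma, Finset.mem_erase] at ha
    exact ha.2.1 (congrArg Sigma.fst h)
  · rintro ⟨i, j⟩ ha
    simp only [Finset.mem_sigma, Finset.mem_erase] at ha ⊢
    exact ⟨ha.2.2, Ne.symm ha.2.1, ha.1⟩
  · rintro ⟨i, j⟩ _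
    rfl

/-- Contraction of a family with the index `k`. -/
def cechContract {M : Type*} [AddCommGroup M] [Module ℝ M] (k : ι) (w : Finset ι → M)
    (J : Finset ι) : M :=
  if k ∈ J then 0 else cechSign k J • w (insert k J)

/-- Contraction with `k` is a contracting homotopy, up to the differential at `insert k J`. -/
lemma sum_cechSign_mul_cechContract (w : Finset ι → ℝ) (k : ι) (J : Finset ι)
    (hw : k ∉ J →
      ∑ i ∈ insert k J, cechSign i (insert k J) * w ((insert k J).erase i) = 0) :
    ∑ i ∈ J, cechSign i J * cechContract k w (J.erase i) = w J := by
  by_cases hk : k ∈ J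
  · rw [Finset.sum_eq_single_of_mem k hk]
    · rw [cechContract, if_neg (Finset.notMem_erase k J), Finset.insert_erase hk,
        cechSign_erase_of_not_lt (lt_irrefl k), smul_eq_mul, ← mul_assoc, cechSign_mul_self,
        one_mul]
    · intro i _ hik
      rw [cechContract, if_pos (Finset.mem_erase.2 ⟨Ne.symm hik, hk⟩), mul_zero]
  · have h := hw hk
    rw [Finset.sum_insert hk, Finset.erase_insert hk] at h
    have key : ∀ i ∈ J, cechSign i J * cechContract k w (J.erase i) =
        -cechSign k (insert k J) *
          (cechSign i (insert k J) * w ((insert k J).erase i)) := by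
      intro i hi
      have hik : i ≠ k := fun h => hk (h ▸ hi)
      have hs := cechSign_mul_erase (J := insert k J) (Ne.symm hik)
        (Finset.mem_insert_self k J) (Finset.mem_insert_of_mem hi)
      have h1 := cechSign_mul_self k (insert k J)
      have h2 := cechSign_mul_self k ((insert k J).erase i)
      have h3 : cechSign k (J.erase i) = cechSign k ((insert k J).erase i) := by
        rw [Finset.erase_insert_of_ne (Ne.symm hik),
          ← cechSign_erase_of_not_lt (lt_irrefl k) (insert k (J.erase i)), Finset.erase_insert]
        exact fun h => hk (Finset.mem_of_mem_erase h)
      rw [Finset.erase_insert hk] at hs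
      rw [cechContract, if_neg (fun h => hk (Finset.mem_of_mem_erase h)), smul_eq_mul, h3,
        ← Finset.erase_insert_of_ne (Ne.symm hik)]
      linear_combination (cechSign k (insert k J) * cechSign k ((insert k J).erase i) * hs
        - cechSign k ((insert k J).erase i) * cechSign i J * h1
        - cechSign k (insert k J) * cechSign i (insert k J) * h2)
          * w ((insert k J).erase i)
    rw [Finset.sum_congr rfl key, ← Finset.mul_sum]
    linear_combination (-cechSign k (insert k J)) * h + w J * cechSign_mul_self k (insert k J)

end Sign

section Cochain

variable {n : ℕ} {ι : Type*} {U : ι → Set (Fin n → ℝ)}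

lemma mem_UJ {J : Finset ι} {x : Fin n → ℝ} : x ∈ UJ U J ↔ ∀ i ∈ J, x ∈ U i := by
  simp [UJ]

lemma cechδ_apply_of_mem [LinearOrder ι] {J : Finset ι} {x : Fin n → ℝ} (hx : x ∈ UJ U J)
    (ω : Finset ι → (Fin n → ℝ) → ℝ) :
    cechδ U ω J x = ∑ i ∈ J, cechSign i J * ω (J.erase i) x := by
  rw [cechδ, if_pos hx]; rfl

lemma cechδ_apply_of_notMem [LinearOrder ι] {J : Finset ι} {x : Fin n → ℝ} (hx : x ∉ UJ U J)
    (ω : Finset ι → (Fin n → ℝ) → ℝ) : cechδ U ω J x = 0 := by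
  rw [cechδ, if_neg hx]

lemma zero_mem_ObsSet (V : Set (Fin n → ℝ)) : (0 : (Fin n → ℝ) → ℝ) ∈ ObsSet V :=
  ⟨contDiffOn_const, fun _ _ => rfl, 1, one_pos, fun _ _ => rfl⟩

lemma add_mem_ObsSet {V : Set (Fin n → ℝ)} {f g : (Fin n → ℝ) → ℝ} (hf : f ∈ ObsSet V)
    (hg : g ∈ ObsSet V) : f + g ∈ ObsSet V := by
  obtain ⟨hf, hf0, r, hr, hfr⟩ := hf
  obtain ⟨hg, hg0, s, _, hgs⟩ := hg
  refine ⟨hf.add hg, fun x hx => by simp [hf0 x hx, hg0 x hx], max r s, lt_max_of_lt_left hr,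
    fun x hx => ?_⟩
  simp [hfr x (le_trans (le_max_left _ _) hx), hgs x (le_trans (le_max_right _ _) hx)]

lemma sum_mem_ObsSet {V : Set (Fin n → ℝ)} {κ : Type*} {S : Finset κ}
    {f : κ → (Fin n → ℝ) → ℝ} (hf : ∀ k ∈ S, f k ∈ ObsSet V) : ∑ k ∈ S, f k ∈ ObsSet V :=
  Finset.sum_induction _ (· ∈ ObsSet V) (fun _ _ => add_mem_ObsSet) (zero_mem_ObsSet V) hf

lemma smul_mem_ObsSet {V : Set (Fin n → ℝ)} {f : (Fin n → ℝ) → ℝ} (c : ℝ)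
    (hf : f ∈ ObsSet V) : c • f ∈ ObsSet V := by
  obtain ⟨hf, hf0, r, hr, hfr⟩ := hf
  exact ⟨hf.const_smul c, fun x hx => by simp [hf0 x hx], r, hr, fun x hx => by simp [hfr x hx]⟩

/-- Multiplication by a smooth function supported in `W` extends sections from `W ∩ V`
to `V` by zero. -/
lemma mul_mem_ObsSet_of_tsupport_subset {V W : Set (Fin n → ℝ)} (hV : IsOpen V) (hW : IsOpen W)
    {ρ f : (Fin n → ℝ) → ℝ} (hρ : ContDiff ℝ (⊤ : ℕ∞) ρ) (hsub : tsupport ρ ⊆ W)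
    (hf : f ∈ ObsSet (W ∩ V)) : ρ * f ∈ ObsSet V := by
  obtain ⟨hf, hf0, r, hr, hfr⟩ := hf
  refine ⟨fun x hx => ?_, fun x hx => by simp [hf0 x fun h => hx h.2], r, hr,
    fun x hx => by simp [hfr x hx]⟩
  apply ContDiffAt.contDiffWithinAt
  by_cases hxW : x ∈ W
  · exact hρ.contDiffAt.mul (hf.contDiffAt ((hW.inter hV).mem_nhds ⟨hxW, hx⟩))
  · have h0 : ρ =ᶠ[nhds x] 0 := notMem_tsupport_iff_eventuallyEq.1 fun h => hxW (hsub h)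
    refine (contDiffAt_const (c := (0 : ℝ))).congr_of_eventuallyEq ?_
    filter_upwards [h0] with y hy
    simp [hy]

lemma isOpen_UJ (hopen : ∀ i, IsOpen (U i)) (J : Finset ι) : IsOpen (UJ U J) :=
  isOpen_biInter_finset fun i _ => hopen i

lemma exists_smooth_partition (hopen : ∀ i, IsOpen (U i)) (hcover : (⋃ i, U i) = Set.univ) :
    ∃ ρ : ι → (Fin n → ℝ) → ℝ, (∀ i, ContDiff ℝ (⊤ : ℕ∞) (ρ i)) ∧
      (∀ i, tsupport (ρ i) ⊆ U i) ∧ ∀ x, ∑ᶠ i, ρ i x = 1 := by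
  obtain ⟨ρ, hρ⟩ := SmoothPartitionOfUnity.exists_isSubordinate
    (modelWithCornersSelf ℝ (Fin n → ℝ)) isClosed_univ U hopen hcover.ge
  exact ⟨fun i => ρ i, fun i => (ρ i).contMDiff.contDiff, hρ, fun x => ρ.sum_eq_one trivial⟩

end Cochain

section Homotopy

variable {n : ℕ} {ι : Type*} [LinearOrder ι] {U : ι → Set (Fin n → ℝ)}

lemma cechδ_eq_zero_of_eq_cechδ {p : ℕ} {ω η : Finset ι → (Fin n → ℝ) → ℝ}
    (h : ∀ J : Finset ι, J.card = p + 1 → ω J = cechδ U η J) (J : Finset ι)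
    (hJ : J.card = p + 2) : cechδ U ω J = 0 := by
  funext x
  by_cases hx : x ∈ UJ U J
  · rw [cechδ_apply_of_mem hx, Pi.zero_apply, ← sum_cechSign_sum_cechSign (fun K => η K x) J]
    refine Finset.sum_congr rfl fun i hi => ?_
    have hxi : x ∈ UJ U (J.erase i) :=
      mem_UJ.2 fun j hj => mem_UJ.1 hx j (Finset.mem_of_mem_erase hj)
    rw [h _ (by rw [Finset.card_erase_of_mem hi, hJ]; rfl), cechδ_apply_of_mem hxi]
  · exact cechδ_apply_of_notMem hx ω

/-- The homotopy operator of a partition of unity `ρ`, with the sum restricted to `S`. -/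
def cechHomotopy (ρ : ι → (Fin n → ℝ) → ℝ) (S : Finset ι)
    (ω : Finset ι → (Fin n → ℝ) → ℝ) (J : Finset ι) : (Fin n → ℝ) → ℝ :=
  ∑ k ∈ S, ρ k * cechContract k ω J

lemma cechContract_apply (k : ι) (ω : Finset ι → (Fin n → ℝ) → ℝ) (J : Finset ι)
    (x : Fin n → ℝ) : cechContract k ω J x = cechContract k (fun K => ω K x) J := by
  unfold cechContract
  split_ifs <;> rfl

lemma isCochain_cechHomotopy (hopen : ∀ i, IsOpen (U i)) {ρ : ι → (Fin n → ℝ) → ℝ}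
    (hρ : ∀ i, ContDiff ℝ (⊤ : ℕ∞) (ρ i)) (hsub : ∀ i, tsupport (ρ i) ⊆ U i) {q : ℕ}
    {ω : Finset ι → (Fin n → ℝ) → ℝ} (hω : IsCochain U (q + 1) ω) (S : Finset ι) :
    IsCochain U q (cechHomotopy ρ S ω) := by
  obtain ⟨hobs, hfin, hcard⟩ := hω
  refine ⟨fun J hJ => sum_mem_ObsSet fun k _ => ?_, ?_, fun J hJ => Finset.sum_eq_zero fun k _ => ?_⟩
  · unfold cechContract
    split_ifs with hk
    · rw [mul_zero]; exact zero_mem_ObsSet _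
    · refine mul_mem_ObsSet_of_tsupport_subset (isOpen_UJ hopen J) (hopen k) (hρ k) (hsub k)
        (smul_mem_ObsSet _ ?_)
      have h := hobs (insert k J) (by rw [Finset.card_insert_of_notMem hk, hJ])
      rwa [UJ, Finset.set_biInter_insert] at h
  · refine (hfin.biUnion fun K _ => K.powerset.finite_toSet).subset fun J hJ => ?_
    obtain ⟨k, _, hk⟩ := Finset.exists_ne_zero_of_sum_ne_zero hJ
    refine Set.mem_biUnion (x := insert k J) (fun h : ω (insert k J) = 0 => hk ?_)
      (Finset.mem_coe.2 (Finset.mem_powerset.2 (Finset.subset_insert k J)))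
    simp [cechContract, h]
  · unfold cechContract
    split_ifs with hk
    · exact mul_zero _
    · rw [hcard _ (by rw [Finset.card_insert_of_notMem hk]; omega), smul_zero, mul_zero]

lemma cechδ_cechHomotopy {ρ : ι → (Fin n → ℝ) → ℝ}
    (hsub : ∀ i, tsupport (ρ i) ⊆ U i) (hsum : ∀ x, ∑ᶠ i, ρ i x = 1) {p : ℕ}
    {ω : Finset ι → (Fin n → ℝ) → ℝ} (hω : IsCochain U p ω)
    (hδ : ∀ J : Finset ι, J.card = p + 2 → cechδ U ω J = 0) {S : Finset ι}
    (hS : ∀ J, ω J ≠ 0 → J ⊆ S) {J : Finset ι} (hJ : J.card = p + 1) :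
    cechδ U (cechHomotopy ρ S ω) J = ω J := by
  funext x
  by_cases hx : x ∈ UJ U J
  swap
  · rw [cechδ_apply_of_notMem hx, (hω.1 J hJ).2.1 x hx]
  have key (k : ι) : ρ k x * ∑ i ∈ J, cechSign i J * cechContract k (fun K => ω K x) (J.erase i)
      = ρ k x * ω J x := by
    by_cases hk : ρ k x = 0
    · rw [hk, zero_mul, zero_mul]
    rw [sum_cechSign_mul_cechContract]
    intro hkJ
    have hxk : x ∈ UJ U (insert k J) := mem_UJ.2 <| by
      intro i hi
      rcases Finset.mem_insert.1 hi with rfl | hi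
      · exact hsub _ (subset_tsupport _ hk)
      · exact mem_UJ.1 hx i hi
    rw [← cechδ_apply_of_mem hxk, hδ _ (by rw [Finset.card_insert_of_notMem hkJ, hJ]),
      Pi.zero_apply]
  have hout (k : ι) (hk : k ∉ S) : ρ k x * ω J x = 0 := by
    rw [← key k, Finset.sum_eq_zero, mul_zero]
    intro i _
    have h0 : ω (insert k (J.erase i)) = 0 := by
      by_contra h
      exact hk (hS _ h (Finset.mem_insert_self _ _))
    simp [cechContract, h0]
  have htot : (∑ k ∈ S, ρ k x) * ω J x = ω J x := by
    by_cases h0 : ω J x = 0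
    · rw [h0, mul_zero]
    · rw [← finsum_eq_sum_of_support_subset, hsum, one_mul]
      intro k hk
      by_contra hkS
      exact (mul_ne_zero hk h0) (hout k hkS)
  rw [cechδ_apply_of_mem hx, ← htot, Finset.sum_mul, ← Finset.sum_congr rfl fun k _ => key k]
  simp only [cechHomotopy, Finset.sum_apply, Pi.mul_apply, cechContract_apply, Finset.mul_sum]
  rw [Finset.sum_comm]
  exact Finset.sum_congr rfl fun k _ => Finset.sum_congr rfl fun i _ => mul_left_comm _ _ _

end Homotopy

/-- for a linearly ordered, locally finite open cover `𝔘` of `ℝ^n`, the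
Čech complex with coefficients in boundedly supported smooth functions is exact in degrees
`p ≥ 1`: a `p`-cochain is a cocycle iff it is the Čech differential of a
`(p-1)`-cochain. -/
theorem stmt13 (n : ℕ) (ι : Type*) [LinearOrder ι] (U : ι → Set (Fin n → ℝ))
    (hinj : Function.Injective U)
    (hopen : ∀ i, IsOpen (U i))
    (hcover : (⋃ i, U i) = Set.univ)
    (hlf : ∀ K : Set (Fin n → ℝ), IsCompact K → {i : ι | (U i ∩ K).Nonempty}.Finite) :
    ∀ p : ℕ, 1 ≤ p → ∀ ω : Finset ι → (Fin n → ℝ) → ℝ, IsCochain U p ω →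
      ((∀ J' : Finset ι, J'.card = p + 2 → cechδ U ω J' = 0) ↔
        ∃ η : Finset ι → (Fin n → ℝ) → ℝ, IsCochain U (p - 1) η ∧
          ∀ J : Finset ι, J.card = p + 1 → ω J = cechδ U η J) := by
  intro p hp ω hω
  obtain ⟨q, rfl⟩ := Nat.exists_eq_add_of_le' hp
  refine ⟨fun hδ => ?_, fun ⟨η, _, h⟩ => cechδ_eq_zero_of_eq_cechδ h⟩
  obtain ⟨ρ, hρ, hsub, hsum⟩ := exists_smooth_partition hopen hcover
  let S : Finset ι := hω.2.1.toFinset.biUnion id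
  have hS (J : Finset ι) (hJ : ω J ≠ 0) : J ⊆ S :=
    Finset.subset_biUnion_of_mem id (hω.2.1.mem_toFinset.2 hJ)
  exact ⟨cechHomotopy ρ S ω, isCochain_cechHomotopy hopen hρ hsub hω S,
    fun J hJ => (cechδ_cechHomotopy hsub hsum hω hδ hS hJ).symm⟩
end
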